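/- Let G be a finitely generated Abelian group of rank d and let S be a finite symmetric generating set of G. Then limsup_{r → ∞} β_{G,S}(r) / β_d(r) ≥ |tors G|, where the quotient is taken in the real numbers. -/

import Mathlib

/-- `S` is a monoid generating set of the group `G`: every element of `G` is a
product of finitely many elements of `S`. -/
def IsMonGenSet {G : Type*} [Group G] (S : Set G) : Prop := Submonoid.closure S = ⊤

/-- `S` is symmetric: closed under inverses. -/
def IsSymmSet {G : Type*} [Group G] (S : Set G) : Prop := ∀ s ∈ S, s⁻¹ ∈ S

/-- The word length of `g` with respect to `S`: the least `n` such that `g` is a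
product of `n` elements of `S`. -/
noncomputable def wlen {G : Type*} [Group G] (S : Set G) (g : G) : ℕ :=
  sInf {n | ∃ l : List G, (∀ x ∈ l, x ∈ S) ∧ l.length = n ∧ l.prod = g}

/-- The growth function `β_{G,S}`: the cardinality of the ball of radius `r`. -/
noncomputable def growth {G : Type*} [Group G] (S : Set G) (r : ℕ) : ℕ :=
  Set.ncard {g : G | wlen S g ≤ r}

/-- The spherical growth function `σ_{G,S}`. -/
noncomputable def sph {G : Type*} [Group G] (S : Set G) (r : ℕ) : ℕ :=
  Set.ncard {g : G | wlen S g = r}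

/-- The standard symmetric generating set `E_d ∪ (-E_d)` of `ℤ^d`. -/
def stdSymmSet (d : ℕ) : Set (Multiplicative (Fin d → ℤ)) :=
  {x | ∃ i : Fin d, x = Multiplicative.ofAdd (Pi.single i 1) ∨
       x = Multiplicative.ofAdd (-Pi.single i 1)}

/-- The standard symmetric growth function `β_d` of `ℤ^d`. -/
noncomputable def betaStd (d : ℕ) : ℕ → ℕ := growth (stdSymmSet d)

/-- The standard monoid generating set `E_d ∪ {v_d}` of `ℤ^d`. -/
def stdMonSet (d : ℕ) : Set (Multiplicative (Fin d → ℤ)) :=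
  {x | (∃ i : Fin d, x = Multiplicative.ofAdd (Pi.single i 1)) ∨
       x = Multiplicative.ofAdd (fun _ => (-1 : ℤ))}

/-- The standard monoid growth function `β⁺_d` of `ℤ^d`. -/
noncomputable def betaPlus (d : ℕ) : ℕ → ℕ := growth (stdMonSet d)

/-- The rank of a finitely generated abelian group. -/
noncomputable def rk (G : Type*) [CommGroup G] : ℕ := Module.finrank ℤ (Additive G)

section WordLength

variable {G : Type*} [Group G] {S : Set G}

lemma IsMonGenSet.exists_list (hS : IsMonGenSet S) (g : G) :
    ∃ l : List G, (∀ x ∈ l, x ∈ S) ∧ l.length = wlen S g ∧ l.prod = g := by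
  have hne : {n | ∃ l : List G, (∀ x ∈ l, x ∈ S) ∧ l.length = n ∧ l.prod = g}.Nonempty := by
    obtain ⟨l, hl, rfl⟩ := Submonoid.exists_list_of_mem_closure
      (show g ∈ Submonoid.closure S from hS ▸ Submonoid.mem_top g)
    exact ⟨l.length, l, hl, rfl, rfl⟩
  exact Nat.sInf_mem hne

lemma wlen_list_prod_le {l : List G} (hl : ∀ x ∈ l, x ∈ S) : wlen S l.prod ≤ l.length :=
  Nat.sInf_le ⟨l, hl, rfl, rfl⟩

@[simp]
lemma wlen_one : wlen S (1 : G) = 0 :=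
  Nat.le_zero.1 (wlen_list_prod_le (S := S) (l := []) (by simp))

lemma wlen_le_one {s : G} (hs : s ∈ S) : wlen S s ≤ 1 := by
  simpa using wlen_list_prod_le (S := S) (l := [s]) (by simpa using hs)

lemma IsMonGenSet.wlen_mul_le (hS : IsMonGenSet S) (g h : G) :
    wlen S (g * h) ≤ wlen S g + wlen S h := by
  obtain ⟨l, hl, hlen, hg⟩ := hS.exists_list g
  obtain ⟨m, hm, hmen, hh⟩ := hS.exists_list h
  rw [← hlen, ← hmen, ← List.length_append]
  have := wlen_list_prod_le (S := S) (l := l ++ m) (by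
    intro x hx
    exact (List.mem_append.1 hx).elim (hl x) (hm x))
  rwa [List.prod_append, hg, hh] at this

lemma IsMonGenSet.wlen_prod_le {G : Type*} [CommGroup G] {S : Set G} (hS : IsMonGenSet S)
    {ι : Type*} (t : Finset ι) (g : ι → G) :
    wlen S (∏ i ∈ t, g i) ≤ ∑ i ∈ t, wlen S (g i) := by
  classical
  induction t using Finset.induction_on with
  | empty => simp
  | insert i t hi ih =>
    rw [Finset.prod_insert hi, Finset.sum_insert hi]
    exact (hS.wlen_mul_le _ _).trans (Nat.add_le_add_left ih _)

lemma IsMonGenSet.wlen_pow_le (hS : IsMonGenSet S) {s : G} (hs : s ∈ S) (n : ℕ) :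
    wlen S (s ^ n) ≤ n := by
  induction n with
  | zero => simp
  | succ n ih =>
    rw [pow_succ]
    exact (hS.wlen_mul_le _ _).trans (add_le_add ih (wlen_le_one hs))

lemma IsMonGenSet.wlen_zpow_le (hS : IsMonGenSet S) (hsymm : IsSymmSet S) {s : G} (hs : s ∈ S)
    (n : ℤ) : wlen S (s ^ n) ≤ n.natAbs := by
  obtain ⟨n, rfl | rfl⟩ := n.eq_nat_or_neg
  · simpa using hS.wlen_pow_le hs n
  · simpa using hS.wlen_pow_le (hsymm s hs) n

lemma IsMonGenSet.wlen_map_le {H : Type*} [Group H] {A : Set H} (hA : IsMonGenSet A)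
    (φ : H →* G) (hφ : ∀ a ∈ A, φ a ∈ S) (h : H) : wlen S (φ h) ≤ wlen A h := by
  obtain ⟨l, hl, hlen, hh⟩ := hA.exists_list h
  have := wlen_list_prod_le (S := S) (l := l.map φ) (by
    intro x hx
    obtain ⟨a, ha, rfl⟩ := List.mem_map.1 hx
    exact hφ a (hl a ha))
  rwa [← map_list_prod, hh, List.length_map, hlen] at this

lemma IsMonGenSet.abs_apply_le (hS : IsMonGenSet S) {d K : ℕ}
    (f : G →* Multiplicative (Fin d → ℤ)) (hK : ∀ s ∈ S, ∀ i, |(f s).toAdd i| ≤ K)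
    (g : G) (i : Fin d) : |(f g).toAdd i| ≤ K * wlen S g := by
  obtain ⟨l, hl, hlen, rfl⟩ := hS.exists_list g
  rw [← hlen]
  clear hlen
  induction l with
  | nil => simp
  | cons a l ih =>
    have h1 := hK a (hl a (by simp)) i
    have h2 := ih fun x hx => hl x (by simp [hx])
    rw [List.prod_cons, map_mul, toAdd_mul, Pi.add_apply, List.length_cons]
    refine (abs_add_le _ _).trans ?_
    push_cast
    linarith

/-- Balls are finite and grow at most polynomially, of degree the rank of the image of a
homomorphism to `ℤ^d` with finite kernel. -/
lemma IsMonGenSet.ball_finite_and_growth_le (hS : IsMonGenSet S) {d K : ℕ}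
    (f : G →* Multiplicative (Fin d → ℤ)) (hf : Function.Surjective f) [Finite f.ker]
    (hK : ∀ s ∈ S, ∀ i, |(f s).toAdd i| ≤ K) (r : ℕ) :
    {g : G | wlen S g ≤ r}.Finite ∧ growth S r ≤ Nat.card f.ker * (2 * K * r + 1) ^ d := by
  obtain ⟨σ, hσ⟩ := hf.hasRightInverse
  let F : G → f.ker × (Fin d → ℤ) := fun g =>
    (⟨g * (σ (f g))⁻¹, by simp [MonoidHom.mem_ker, hσ (f g)]⟩, (f g).toAdd)
  have hF : Set.InjOn F {g : G | wlen S g ≤ r} := by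
    intro g _ h _ hgh
    simp only [F, Prod.mk.injEq, Subtype.mk.injEq, EmbeddingLike.apply_eq_iff_eq] at hgh
    rw [hgh.2] at hgh
    exact mul_right_cancel hgh.1
  let B : Finset (Fin d → ℤ) := Finset.Icc (fun _ => -(K * r : ℤ)) (fun _ => (K * r : ℤ))
  have hmaps : Set.MapsTo F {g : G | wlen S g ≤ r} ((Set.univ : Set f.ker) ×ˢ (B : Set _)) := by
    intro g hg
    have hbound : ∀ i, |(f g).toAdd i| ≤ K * r := fun i =>
      (hS.abs_apply_le f hK g i).trans (by
        have : wlen S g ≤ r := hg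
        gcongr)
    simp only [Set.mem_prod, Set.mem_univ, true_and, B, F, Finset.coe_Icc, Set.mem_Icc]
    exact ⟨fun i => (abs_le.1 (hbound i)).1, fun i => (abs_le.1 (hbound i)).2⟩
  have hfin : ((Set.univ : Set f.ker) ×ˢ (B : Set (Fin d → ℤ))).Finite :=
    Set.finite_univ.prod B.finite_toSet
  refine ⟨Set.Finite.of_injOn hmaps hF hfin, ?_⟩
  refine (Set.ncard_le_ncard_of_injOn F hmaps hF hfin).trans (le_of_eq ?_)
  rw [Set.ncard_prod, Set.ncard_univ, Set.ncard_coe_finset, Pi.card_Icc]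
  simp only [Int.card_Icc, Finset.prod_const, Finset.card_univ, Fintype.card_fin]
  congr 2
  have : (K * r : ℤ) + 1 - -(K * r : ℤ) = ((2 * K * r + 1 : ℕ) : ℤ) := by push_cast; ring
  rw [this, Int.toNat_natCast]

end WordLength

section Standard

variable (d : ℕ)

lemma isSymmSet_stdSymmSet : IsSymmSet (stdSymmSet d) := by
  rintro _ ⟨i, rfl | rfl⟩
  · exact ⟨i, Or.inr rfl⟩
  · exact ⟨i, Or.inl (by simp [← ofAdd_neg])⟩

/-- The homomorphism from `ℤ^d` sending the standard basis to a given family. -/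
def stdLift {G : Type*} [CommGroup G] {d : ℕ} (s : Fin d → G) :
    Multiplicative (Fin d → ℤ) →* G where
  toFun x := ∏ j, s j ^ x.toAdd j
  map_one' := by simp
  map_mul' x y := by simp [zpow_add, Finset.prod_mul_distrib]

lemma stdLift_apply {G : Type*} [CommGroup G] {d : ℕ} (s : Fin d → G)
    (x : Multiplicative (Fin d → ℤ)) : stdLift s x = ∏ j, s j ^ x.toAdd j := rfl

lemma stdLift_mem_of_mem_stdSymmSet {G : Type*} [CommGroup G] {S : Set G} (hsymm : IsSymmSet S)
    {d : ℕ} {s : Fin d → G} (hs : ∀ j, s j ∈ S) {x : Multiplicative (Fin d → ℤ)}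
    (hx : x ∈ stdSymmSet d) : stdLift s x ∈ S := by
  have key : ∀ i, stdLift s (Multiplicative.ofAdd (Pi.single i 1)) = s i := fun i => by
    simp only [stdLift_apply, toAdd_ofAdd]
    rw [Finset.prod_eq_single i (fun j _ hj => by simp [Pi.single_eq_of_ne hj]) (by simp)]
    simp
  obtain ⟨i, rfl | rfl⟩ := hx
  · exact key i ▸ hs i
  · rw [ofAdd_neg, map_inv, key]
    exact hsymm _ (hs i)

lemma stdLift_single_apply (x : Multiplicative (Fin d → ℤ)) :
    stdLift (fun i => Multiplicative.ofAdd (Pi.single i (1 : ℤ))) x = x := by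
  apply Multiplicative.toAdd.injective
  simp only [stdLift_apply, toAdd_prod, toAdd_zpow, toAdd_ofAdd]
  ext i
  simp [Finset.sum_apply, Pi.single_apply]

lemma isMonGenSet_stdSymmSet : IsMonGenSet (stdSymmSet d) := by
  refine (Submonoid.eq_top_iff' _).2 fun x => ?_
  rw [← stdLift_single_apply d x, stdLift_apply]
  refine Submonoid.prod_mem _ fun i _ => ?_
  have hi : Multiplicative.ofAdd (Pi.single i (1 : ℤ)) ∈ stdSymmSet d := ⟨i, Or.inl rfl⟩
  obtain ⟨n, hn | hn⟩ := (x.toAdd i).eq_nat_or_neg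
  · rw [hn, zpow_natCast]
    exact Submonoid.pow_mem _ (Submonoid.subset_closure hi) _
  · rw [hn, zpow_neg, zpow_natCast, ← inv_pow]
    exact Submonoid.pow_mem _ (Submonoid.subset_closure (isSymmSet_stdSymmSet d _ hi)) _

lemma wlen_stdSymmSet_le (x : Multiplicative (Fin d → ℤ)) :
    wlen (stdSymmSet d) x ≤ ∑ i, (x.toAdd i).natAbs := by
  conv_lhs => rw [← stdLift_single_apply d x, stdLift_apply]
  have hgen := isMonGenSet_stdSymmSet d
  refine (hgen.wlen_prod_le Finset.univ _).trans ?_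
  exact Finset.sum_le_sum fun i _ =>
    hgen.wlen_zpow_le (isSymmSet_stdSymmSet d) ⟨i, Or.inl rfl⟩ _

lemma ball_stdSymmSet_finite_and_betaStd_le (r : ℕ) :
    {x | wlen (stdSymmSet d) x ≤ r}.Finite ∧ betaStd d r ≤ (2 * r + 1) ^ d := by
  have hker : (MonoidHom.id (Multiplicative (Fin d → ℤ))).ker = ⊥ :=
    (MonoidHom.ker_eq_bot_iff _).2 Function.injective_id
  have : Finite (MonoidHom.id (Multiplicative (Fin d → ℤ))).ker := by
    rw [hker]
    infer_instance
  have := (isMonGenSet_stdSymmSet d).ball_finite_and_growth_le (K := 1) (MonoidHom.id _)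
    Function.surjective_id (by
      rintro _ ⟨i, rfl | rfl⟩ j <;> by_cases h : j = i <;>
        simp [h]) r
  simpa [hker, betaStd] using this

lemma pow_le_betaStd (r : ℕ) : (2 * (r / d) + 1) ^ d ≤ betaStd d r := by
  let k := r / d
  let B : Finset (Fin d → ℤ) := Finset.Icc (fun _ => -(k : ℤ)) (fun _ => (k : ℤ))
  have hcard : B.card = (2 * k + 1) ^ d := by
    simp only [B, Pi.card_Icc, Int.card_Icc, Finset.prod_const, Finset.card_univ,
      Fintype.card_fin]
    congr 1
    lia
  rw [← hcard, ← Set.ncard_coe_finset]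
  refine Set.ncard_le_ncard_of_injOn Multiplicative.ofAdd (fun x hx => ?_)
    Multiplicative.ofAdd.injective.injOn (ball_stdSymmSet_finite_and_betaStd_le d r).1
  have hx' : ∀ i, (x i).natAbs ≤ k := fun i => by
    have h := Finset.mem_Icc.1 (Finset.mem_coe.1 hx)
    have h1 := h.1 i
    have h2 := h.2 i
    simp only at h1 h2
    lia
  calc wlen (stdSymmSet d) (Multiplicative.ofAdd x) ≤ ∑ i, (x i).natAbs :=
        wlen_stdSymmSet_le d _
    _ ≤ ∑ _i : Fin d, k := Finset.sum_le_sum fun i _ => hx' i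
    _ = d * (r / d) := by simp [k]
    _ ≤ r := Nat.mul_div_le r d

lemma betaStd_pos (r : ℕ) : 0 < betaStd d r :=
  (by positivity : 0 < (2 * (r / d) + 1) ^ d).trans_le (pow_le_betaStd d r)

lemma pow_le_mul_betaStd (K r : ℕ) :
    (2 * K * r + 1) ^ d ≤ (2 * K * d + 1) ^ d * betaStd d r := by
  refine le_trans ?_ (Nat.mul_le_mul_left _ (pow_le_betaStd d r))
  rcases Nat.eq_zero_or_pos d with rfl | hd
  · simp
  rw [← mul_pow]
  refine Nat.pow_le_pow_left ?_ d
  have h := (Nat.lt_mul_div_succ r hd).le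
  generalize r / d = q at h ⊢
  calc 2 * K * r + 1 ≤ 2 * K * (d * (q + 1)) + 1 := by gcongr
    _ ≤ 2 * K * (d * (q + 1)) + 1 + (2 * K * d * q + 2 * q) := Nat.le_add_right _ _
    _ = (2 * K * d + 1) * (2 * q + 1) := by ring

/-- Polynomial growth rules out growth by a factor bounded away from `1` on shifts by `c`. -/
lemma frequently_betaStd_add_lt (c : ℕ) {ρ : ℝ} (hρ : 1 < ρ) :
    ∃ᶠ r in Filter.atTop, (betaStd d (r + c) : ℝ) < ρ * betaStd d r := by
  intro hev
  obtain ⟨r₀, hr₀⟩ := Filter.eventually_atTop.1 hev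
  have hexp : ∀ k : ℕ, ρ ^ k ≤ betaStd d (r₀ + c * k) := by
    intro k
    induction k with
    | zero => simpa using Nat.one_le_iff_ne_zero.2 (betaStd_pos d r₀).ne'
    | succ k ih =>
      have := not_lt.1 (hr₀ (r₀ + c * k) (Nat.le_add_right _ _))
      rw [pow_succ', mul_add, mul_one, ← add_assoc]
      exact (mul_le_mul_of_nonneg_left ih (by positivity)).trans this
  have hle : ∀ k : ℕ, 1 ≤ k →
      ρ ^ k ≤ ((2 * (r₀ + c) + 1 : ℕ) : ℝ) ^ d * (k : ℝ) ^ d := by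
    intro k hk
    refine (hexp k).trans ?_
    rw [← mul_pow]
    refine (Nat.cast_le.2 ((ball_stdSymmSet_finite_and_betaStd_le d (r₀ + c * k)).2.trans
      (Nat.pow_le_pow_left (m := (2 * (r₀ + c) + 1) * k) ?_ d))).trans (by push_cast; rfl)
    nlinarith
  set C : ℝ := ((2 * (r₀ + c) + 1 : ℕ) : ℝ) ^ d with hC
  have hCpos : 0 < C := by positivity
  have ht := (tendsto_pow_const_div_const_pow_of_one_lt d hρ).eventually_lt_const
    (inv_pos.2 hCpos)
  obtain ⟨k, hk, hk1⟩ := (ht.and (Filter.eventually_ge_atTop 1)).exists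
  have hρk : 0 < ρ ^ k := by positivity
  rw [div_lt_iff₀ hρk, inv_mul_eq_div, lt_div_iff₀ hCpos, mul_comm] at hk
  exact (hle k hk1).not_gt hk

end Standard

section Abelian

variable {G : Type*} [CommGroup G] {S : Set G}

lemma IsMonGenSet.fg (hS : IsMonGenSet S) (hfin : S.Finite) : Module.Finite ℤ (Additive G) := by
  have : Group.FG G := by
    refine Group.fg_iff.2 ⟨S, ?_, hfin⟩
    refine (Subgroup.eq_top_iff' _).2 fun x => ?_
    exact Subgroup.le_closure_toSubmonoid S (hS ▸ Submonoid.mem_top x)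
  exact Module.Finite.iff_addGroup_fg.2 inferInstance

lemma exists_hom_ker_eq_torsion (G : Type*) [CommGroup G] [Module.Finite ℤ (Additive G)] :
    ∃ f : G →* Multiplicative (Fin (rk G) → ℤ),
      Function.Surjective f ∧ f.ker = CommGroup.torsion G := by
  let T := Submodule.torsion ℤ (Additive G)
  have hrank : Module.finrank ℤ (Additive G ⧸ T) = rk G :=
    finrank_quotient_eq_of_le_torsion le_rfl
  let b := (Module.finBasisOfFinrankEq ℤ (Additive G ⧸ T) hrank).equivFun
  let g : Additive G →+ (Fin (rk G) → ℤ) := (b.toLinearMap ∘ₗ T.mkQ).toAddMonoidHom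
  refine ⟨AddMonoidHom.toMultiplicativeRight g, ?_, ?_⟩
  · intro y
    obtain ⟨x, hx⟩ := (b.surjective.comp T.mkQ_surjective) y.toAdd
    exact ⟨x.toMul, congrArg Multiplicative.ofAdd hx⟩
  · ext x
    have h1 : x ∈ (AddMonoidHom.toMultiplicativeRight g).ker ↔ Additive.ofMul x ∈ T := by
      rw [← Submodule.Quotient.mk_eq_zero, ← b.map_eq_zero_iff]
      rfl
    have h2 : Additive.ofMul x ∈ T ↔ Additive.ofMul x ∈ AddCommGroup.torsion (Additive G) := by
      rw [← Submodule.torsion_int]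
      rfl
    rw [h1, h2]
    exact isOfFinAddOrder_ofMul_iff

lemma finite_torsion [Module.Finite ℤ (Additive G)] : Finite (CommGroup.torsion G) := by
  let T := Submodule.torsion ℤ (Additive G)
  have : Finite T := Module.finite_of_fg_torsion T Submodule.torsion_isTorsion
  refine Finite.of_injective (β := T) (fun x => ⟨Additive.ofMul x.1, ?_⟩) ?_
  · have : Additive.ofMul x.1 ∈ AddCommGroup.torsion (Additive G) :=
      isOfFinAddOrder_ofMul_iff.2 x.2
    rw [← Submodule.torsion_int] at this
    exact this
  · intro x y h
    exact Subtype.ext (congrArg (fun z : T => Additive.toMul z.1) h)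

/-- A generating set contains a family whose image in `ℤ^d` is linearly independent. -/
lemma IsMonGenSet.exists_injective_comp_stdLift (hS : IsMonGenSet S) {d : ℕ}
    (f : G →* Multiplicative (Fin d → ℤ)) (hf : Function.Surjective f) :
    ∃ s : Fin d → G, (∀ j, s j ∈ S) ∧ Function.Injective (f.comp (stdLift s)) := by
  let c : (Fin d → ℤ) →+ (Fin d → ℚ) := (Int.castAddHom ℚ).compLeft (Fin d)
  let q : G → (Fin d → ℚ) := fun g => c (f g).toAdd
  have hspan : Submodule.span ℚ (q '' S) = ⊤ := by
    have hmem : ∀ g, q g ∈ Submodule.span ℚ (q '' S) := by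
      intro g
      have hg : g ∈ Submonoid.closure S := hS ▸ Submonoid.mem_top g
      induction hg using Submonoid.closure_induction with
      | mem x hx => exact Submodule.subset_span ⟨x, hx, rfl⟩
      | one => simp [q]
      | mul x y _ _ hx hy =>
        have : q (x * y) = q x + q y := by simp [q]
        rw [this]
        exact add_mem hx hy
    rw [eq_top_iff, ← (Pi.basisFun ℚ (Fin d)).span_eq, Submodule.span_le]
    rintro _ ⟨i, rfl⟩
    obtain ⟨g, hg⟩ := hf (Multiplicative.ofAdd (Pi.single i 1))
    have : q g = Pi.basisFun ℚ (Fin d) i := by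
      ext j
      simp [q, c, hg, Pi.single_apply]
    exact this ▸ hmem g
  obtain ⟨b, hbS, hbspan, hb⟩ := exists_linearIndependent ℚ (q '' S)
  let B := Module.Basis.mk hb (by rw [Subtype.range_coe, hbspan, hspan])
  let e := B.indexEquiv (Pi.basisFun ℚ (Fin d))
  choose s hsS hs using fun j : Fin d => hbS (e.symm j).2
  refine ⟨s, hsS, (injective_iff_map_eq_one _).2 fun x hx => ?_⟩
  have hli : LinearIndependent ℚ (fun j => q (s j)) := by
    simp only [hs]
    exact hb.comp _ e.symm.injective
  have hsum : ∑ j, (x.toAdd j : ℚ) • q (s j) = 0 := by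
    have h0 : c (f (stdLift s x)).toAdd = 0 := by
      rw [show f (stdLift s x) = 1 from hx]
      simp
    rw [← h0]
    simp only [stdLift_apply, map_prod, map_zpow, toAdd_prod,
      toAdd_zpow, map_sum, map_zsmul, q, Int.cast_smul_eq_zsmul]
  have hzero := Fintype.linearIndependent_iff.1 hli _ hsum
  exact Multiplicative.toAdd.injective (funext fun j => by exact_mod_cast hzero j)

lemma IsMonGenSet.exists_card_torsion_mul_betaStd_le (hS : IsMonGenSet S) (hsymm : IsSymmSet S)
    [Finite (CommGroup.torsion G)] (hball : ∀ r, {g : G | wlen S g ≤ r}.Finite) {d : ℕ}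
    (f : G →* Multiplicative (Fin d → ℤ)) (hf : Function.Surjective f)
    (hker : f.ker = CommGroup.torsion G) :
    ∃ c, ∀ r, Nat.card (CommGroup.torsion G) * betaStd d r ≤ growth S (r + c) := by
  obtain ⟨s, hs, hinj⟩ := hS.exists_injective_comp_stdLift f hf
  obtain ⟨c, hc⟩ := (Set.finite_range fun t : CommGroup.torsion G => wlen S t.1).bddAbove
  refine ⟨c, fun r => ?_⟩
  rw [← Set.ncard_univ, betaStd, growth, ← Set.ncard_prod]
  refine Set.ncard_le_ncard_of_injOn (fun p => p.1.1 * stdLift s p.2) ?_ ?_ (hball _)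
  · rintro ⟨t, x⟩ ⟨-, hx⟩
    have h1 : wlen S t.1 ≤ c := hc ⟨t, rfl⟩
    have h2 := (isMonGenSet_stdSymmSet d).wlen_map_le (stdLift s)
      (fun a => stdLift_mem_of_mem_stdSymmSet hsymm hs) x
    have h3 : wlen (stdSymmSet d) x ≤ r := hx
    have h4 := hS.wlen_mul_le t.1 (stdLift s x)
    change wlen S (t.1 * stdLift s x) ≤ r + c
    lia
  · rintro ⟨t, x⟩ - ⟨u, y⟩ - h
    simp only at h
    have htriv : ∀ v : CommGroup.torsion G, f v.1 = 1 := fun v =>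
      MonoidHom.mem_ker.1 (hker.ge v.2)
    have hxy : x = y := hinj (by simpa [htriv] using congrArg f h)
    subst hxy
    exact Prod.ext (Subtype.ext (mul_right_cancel h)) rfl

end Abelian

/-- Minimal growth, symmetric case: for a finitely generated Abelian group `G` of
rank `d` and a finite symmetric generating set `S`,
`limsup_{r → ∞} β_{G,S}(r) / β_d(r) ≥ |tors G|`. -/
theorem limsup_growth_div_betaStd_ge_card_torsion (G : Type*) [CommGroup G]
    (S : Set G) (hfin : S.Finite) (hsymm : IsSymmSet S) (hgen : IsMonGenSet S) :
    (Nat.card (CommGroup.torsion G) : ℝ) ≤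
      Filter.limsup (fun r : ℕ => (growth S r : ℝ) / (betaStd (rk G) r : ℝ)) Filter.atTop := by
  have := hgen.fg hfin
  have := finite_torsion (G := G)
  obtain ⟨f, hf, hker⟩ := exists_hom_ker_eq_torsion G
  have : Finite f.ker := hker ▸ inferInstance
  obtain ⟨K, hK⟩ : ∃ K : ℕ, ∀ s ∈ S, ∀ i, |(f s).toAdd i| ≤ K := by
    obtain ⟨K, hK⟩ := (hfin.image fun s => ∑ i, ((f s).toAdd i).natAbs).bddAbove
    refine ⟨K, fun s hs i => ?_⟩
    rw [Int.abs_eq_natAbs, Nat.cast_le]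
    exact (Finset.single_le_sum (f := fun i => ((f s).toAdd i).natAbs)
      (fun _ _ => Nat.zero_le _) (Finset.mem_univ i)).trans (hK ⟨s, hs, rfl⟩)
  have hball := hgen.ball_finite_and_growth_le f hf hK
  obtain ⟨c, hc⟩ := hgen.exists_card_torsion_mul_betaStd_le hsymm (fun r => (hball r).1) f hf hker
  have hpos : ∀ r, (0 : ℝ) < betaStd (rk G) r := fun r => Nat.cast_pos.2 (betaStd_pos _ r)
  have hbdd : Filter.IsBoundedUnder (· ≤ ·) Filter.atTop
      (fun r : ℕ => (growth S r : ℝ) / (betaStd (rk G) r : ℝ)) := by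
    refine Filter.isBoundedUnder_of
      ⟨(Nat.card f.ker * (2 * K * rk G + 1) ^ rk G : ℕ), fun r => ?_⟩
    rw [div_le_iff₀ (hpos r), ← Nat.cast_mul, Nat.cast_le, mul_assoc]
    exact (hball r).2.trans (Nat.mul_le_mul_left _ (pow_le_mul_betaStd _ K r))
  have hcard : (0 : ℝ) < Nat.card (CommGroup.torsion G) := Nat.cast_pos.2 Nat.card_pos
  refine le_of_forall_lt_imp_le_of_dense fun a ha => ?_
  refine Filter.le_limsup_of_frequently_le ?_ hbdd
  rcases le_or_gt a 0 with ha0 | ha0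
  · exact Filter.Frequently.of_forall fun r => ha0.trans (by positivity)
  have hfreq := frequently_betaStd_add_lt (rk G) c ((one_lt_div ha0).2 ha)
  refine (Filter.tendsto_add_atTop_nat c).frequently (hfreq.mono fun r hr => ?_)
  rw [le_div_iff₀ (hpos _)]
  rw [div_mul_eq_mul_div, lt_div_iff₀ ha0, mul_comm] at hr
  exact hr.le.trans (by exact_mod_cast hc r)
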